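/- Let φ : (0, 1/2] → ℝ be defined by φ(ε) = (4/π)·(√(1/2 − 2ε) + √ε · arcsin √(ε/(1/2 − ε))) for 0 < ε ≤ 1/4 and φ(ε) = 2√ε for 1/4 < ε ≤ 1/2. Then ∫₀^{1/2} φ(ε)/√(2ε) dε = 1. -/

import Mathlib

open MeasureTheory Real

noncomputable def auxF (t : ℝ) : ℝ :=
  (4/Real.pi) * (√(t * (1/4 - t)) + arcsin (2 * √t) / 2
    + (t - 1/2) * arcsin (√(t / (1/2 - t))) / √2)

lemma derivB (t : ℝ) (h0 : 0 < t) (h1 : t < 1/4) :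
    HasDerivAt (fun t => arcsin (2 * √t)) (1 / (2 * √t * √(1/4 - t))) t := by
  have hx : 0 < √t := Real.sqrt_pos.2 h0
  have hy : 0 < √(1/4 - t) := Real.sqrt_pos.2 (by linarith)
  have hxx : √t ^ 2 = t := Real.sq_sqrt h0.le
  have hyy : √(1/4 - t) ^ 2 = 1/4 - t := Real.sq_sqrt (by linarith)
  have e : √(1 - (2 * √t)^2) = 2 * √(1/4 - t) := by
    rw [Real.sqrt_eq_iff_mul_self_eq_of_pos (by positivity)]
    nlinarith
  have hlt : 2 * √t < 1 := by nlinarith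
  have hd : HasDerivAt (fun t => 2 * √t) (2 * (1 / (2 * √t))) t :=
    (Real.hasDerivAt_sqrt h0.ne').const_mul 2
  have := (Real.hasDerivAt_arcsin (x := 2 * √t) (by linarith) hlt.ne).comp t hd
  refine this.congr_deriv ?_
  rw [e]; field_simp

lemma derivA (t : ℝ) (h0 : 0 < t) (h1 : t < 1/4) :
    HasDerivAt (fun t => arcsin (√(t / (1/2 - t))))
      (1 / (4 * (1/2 - t) * √t * (√2 * √(1/4 - t)))) t := by
  have hx : 0 < √t := Real.sqrt_pos.2 h0
  have hy : 0 < √(1/4 - t) := Real.sqrt_pos.2 (by linarith)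
  have hz : 0 < √(1/2 - t) := Real.sqrt_pos.2 (by linarith)
  have hr : 0 < √2 := by positivity
  have hrr : √2 ^ 2 = 2 := Real.sq_sqrt (by norm_num)
  have hxx : √t ^ 2 = t := Real.sq_sqrt h0.le
  have hyy : √(1/4 - t) ^ 2 = 1/4 - t := Real.sq_sqrt (by linarith)
  have hzz : √(1/2 - t) ^ 2 = 1/2 - t := Real.sq_sqrt (by linarith)
  have hc : 0 < 1/2 - t := by linarith
  have hu : 0 < t / (1/2 - t) := by positivity
  have hu1 : t / (1/2 - t) < 1 := by rw [div_lt_one hc]; linarith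
  have eu : √(t / (1/2 - t)) = √t / √(1/2 - t) := Real.sqrt_div h0.le _
  have e : √(1 - (√(t / (1/2 - t)))^2) = √2 * √(1/4 - t) / √(1/2 - t) := by
    rw [Real.sq_sqrt hu.le, ← Real.sqrt_mul (by norm_num), ← Real.sqrt_div (by linarith)]
    congr 1
    rw [eq_div_iff hc.ne', sub_mul, div_mul_cancel₀ _ hc.ne']
    ring
  have hlt : √(t / (1/2 - t)) < 1 := by
    rw [Real.sqrt_lt' one_pos]; simpa using hu1
  have hg : (-1:ℝ) < √(t / (1/2 - t)) := by
    have := Real.sqrt_nonneg (t / (1/2 - t)); linarith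
  have hq : HasDerivAt (fun t : ℝ => t / (1/2 - t)) ((1 * (1/2 - t) - t * (-1)) / (1/2 - t)^2) t :=
    (hasDerivAt_id t).div ((hasDerivAt_id t).const_sub (1/2)) hc.ne'
  have := (Real.hasDerivAt_arcsin hg.ne' hlt.ne).comp t (hq.sqrt hu.ne')
  refine this.congr_deriv ?_
  rw [e, eu]
  generalize √t = x at *
  generalize √(1/2 - t) = z at *
  generalize √(1/4 - t) = y at *
  rw [← hzz]
  have : 1 * z^2 - t * (-1) = 1/2 := by rw [hzz]; ring
  rw [this]
  field_simp
  norm_num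

lemma derivC (t : ℝ) (h0 : 0 < t) (h1 : t < 1/4) :
    HasDerivAt (fun t => √(t * (1/4 - t)))
      ((1/4 - 2 * t) / (2 * (√t * √(1/4 - t)))) t := by
  have hq : HasDerivAt (fun t : ℝ => t * (1/4 - t)) (1 * (1/4 - t) + t * (-1)) t :=
    (hasDerivAt_id t).mul ((hasDerivAt_id t).const_sub (1/4))
  have hp : 0 < t * (1/4 - t) := mul_pos h0 (by linarith)
  refine (hq.sqrt hp.ne').congr_deriv ?_
  rw [Real.sqrt_mul h0.le]
  congr 1
  ring

lemma derivF (t : ℝ) (h0 : 0 < t) (h1 : t < 1/4) :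
    HasDerivAt auxF ((4/Real.pi) * (√(1/2 - 2*t) + √t * arcsin (√(t/(1/2 - t)))) / √(2*t)) t := by
  have hx : 0 < √t := Real.sqrt_pos.2 h0
  have hy : 0 < √(1/4 - t) := Real.sqrt_pos.2 (by linarith)
  have hr : 0 < √2 := by positivity
  have hrr : √2 ^ 2 = 2 := Real.sq_sqrt (by norm_num)
  have hxx : √t ^ 2 = t := Real.sq_sqrt h0.le
  have hyy : √(1/4 - t) ^ 2 = 1/4 - t := Real.sq_sqrt (by linarith)
  have hc : 0 < 1/2 - t := by linarith
  have e1 : √(1/2 - 2*t) = √2 * √(1/4 - t) := by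
    rw [← Real.sqrt_mul (by norm_num)]; congr 1; ring
  have e2 : √(2*t) = √2 * √t := Real.sqrt_mul (by norm_num) _
  have := (((derivC t h0 h1).add ((derivB t h0 h1).div_const 2)).add
    ((((hasDerivAt_id t).sub_const (1/2)).mul (derivA t h0 h1)).div_const √2)).const_mul (4/Real.pi)
  refine this.congr_deriv ?_
  rw [e1, e2, mul_div_assoc]
  congr 1
  simp only [id]
  generalize arcsin (√(t/(1/2 - t))) = A at *
  have k : (t - 1/2) * (1 / (4 * (1/2 - t) * √t * (√2 * √(1/4 - t)))) = - (1 / (4 * √t * (√2 * √(1/4 - t)))) := by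
    rw [show t - 1/2 = -(1/2 - t) by ring]
    generalize 1/2 - t = c at *
    field_simp
  rw [k]
  generalize √t = x at *
  generalize √(1/4 - t) = y at *
  generalize √2 = r at *
  have k2 : (1 * A + -(1 / (4 * x * (r * y)))) / r = A / r - 1 / (8 * x * y) := by
    have : 1 / (8 * x * y) = 1 / (4 * x * (r^2 * y)) := by rw [hrr]; congr 1; ring
    rw [this]; field_simp
    ring
  have k3 : (r * y + x * A) / (r * x) = y^2 / (x * y) + A / r := by
    field_simp
  rw [k2, k3, hyy]
  field_simp
  ring

lemma contF : ContinuousOn auxF (Set.Icc 0 (1/4)) := by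
  unfold auxF
  have : ContinuousOn (fun t : ℝ => t / (1/2 - t)) (Set.Icc 0 (1/4)) := by
    apply ContinuousOn.div (by fun_prop) (by fun_prop)
    intro t ht
    have := ht.2
    intro h
    linarith
  have h2 : ContinuousOn (fun t : ℝ => arcsin √(t / (1/2 - t))) (Set.Icc 0 (1/4)) :=
    Real.continuous_arcsin.comp_continuousOn this.sqrt
  have h3 : Continuous (fun t : ℝ => arcsin (2 * √t)) := Real.continuous_arcsin.comp (by fun_prop)
  fun_prop

lemma part1 : IntervalIntegrable (fun t => (4/Real.pi) * (√(1/2 - 2*t) + √t * arcsin (√(t/(1/2 - t)))) / √(2*t)) volume 0 (1/4) ∧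
    ∫ t in (0:ℝ)..(1/4), (4/Real.pi) * (√(1/2 - 2*t) + √t * arcsin (√(t/(1/2 - t)))) / √(2*t) = 1 - √2 / 4 := by
  have hi : IntervalIntegrable (fun t => (4/Real.pi) * (√(1/2 - 2*t) + √t * arcsin (√(t/(1/2 - t)))) / √(2*t)) volume 0 (1/4) := by
    rw [intervalIntegrable_iff_integrableOn_Ioc_of_le (by norm_num)]
    apply intervalIntegral.integrableOn_deriv_of_nonneg contF
    · intro t ht
      exact derivF t ht.1 ht.2
    · intro t ht
      have : 0 ≤ arcsin (√(t/(1/2 - t))) := Real.arcsin_nonneg.2 (Real.sqrt_nonneg _)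
      positivity
  refine ⟨hi, ?_⟩
  rw [intervalIntegral.integral_eq_sub_of_hasDerivAt_of_le (by norm_num) contF (fun t ht => derivF t ht.1 ht.2) hi]
  have s4 : √(1/4 : ℝ) = 1/2 := by
    rw [Real.sqrt_eq_iff_mul_self_eq_of_pos (by positivity)]; norm_num
  have hr : 0 < √2 := by positivity
  have hrr : √2 ^ 2 = 2 := Real.sq_sqrt (by norm_num)
  have F0 : auxF 0 = 0 := by simp [auxF]
  have F1 : auxF (1/4) = 1 - 1 / (2 * √2) := by
    unfold auxF
    rw [s4]
    have : (1/4 : ℝ) / (1/2 - 1/4) = 1 := by norm_num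
    rw [this]
    have : (2:ℝ) * (1/2) = 1 := by norm_num
    rw [this]
    simp only [sub_self, mul_zero, Real.sqrt_zero, Real.sqrt_one, Real.arcsin_one]
    have := Real.pi_pos
    field_simp
    ring
  rw [F0, F1]
  have : 1 / (2 * √2) = √2 / 4 := by
    field_simp
    rw [hrr]; norm_num
  rw [this]; ring

/-- The integral of the dimensionless energy-dependent collision frequency
`φ(ε)` against the equilibrium marginal density `1/√(2ε)` of the piston energy
equals one. -/
theorem stmt_11 :
    ∫ ε in (0:ℝ)..(1/2),
        (if ε ≤ 1/4 then
            (4/Real.pi) * (Real.sqrt (1/2 - 2*ε)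
              + Real.sqrt ε * Real.arcsin (Real.sqrt (ε/(1/2 - ε))))
          else 2 * Real.sqrt ε) / Real.sqrt (2*ε) = 1 := by
  have h1 : Set.EqOn (fun t => (4/Real.pi) * (√(1/2 - 2*t) + √t * arcsin (√(t/(1/2 - t)))) / √(2*t))
      (fun ε => (if ε ≤ 1/4 then
            (4/Real.pi) * (Real.sqrt (1/2 - 2*ε)
              + Real.sqrt ε * Real.arcsin (Real.sqrt (ε/(1/2 - ε))))
          else 2 * Real.sqrt ε) / Real.sqrt (2*ε)) (Set.uIoc 0 (1/4)) := by
    intro t ht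
    rw [Set.uIoc_of_le (by norm_num)] at ht
    simp only [if_pos ht.2]
  have h2 : Set.EqOn (fun _ => √2)
      (fun ε => (if ε ≤ 1/4 then
            (4/Real.pi) * (Real.sqrt (1/2 - 2*ε)
              + Real.sqrt ε * Real.arcsin (Real.sqrt (ε/(1/2 - ε))))
          else 2 * Real.sqrt ε) / Real.sqrt (2*ε)) (Set.uIoc (1/4) (1/2)) := by
    intro t ht
    rw [Set.uIoc_of_le (by norm_num)] at ht
    simp only [if_neg (not_le.2 ht.1)]
    have h0 : 0 < t := by linarith [ht.1]
    have hx : 0 < √t := Real.sqrt_pos.2 h0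
    have hr : 0 < √2 := by positivity
    have hrr : √2 ^ 2 = 2 := Real.sq_sqrt (by norm_num)
    rw [Real.sqrt_mul (by norm_num)]
    field_simp
    exact hrr
  rw [← intervalIntegral.integral_add_adjacent_intervals (b := 1/4) (part1.1.congr h1)
    ((intervalIntegrable_const (c := √2)).congr h2),
    ← intervalIntegral.integral_congr_ae (Filter.Eventually.of_forall h1), ← intervalIntegral.integral_congr_ae (Filter.Eventually.of_forall h2), part1.2,
    intervalIntegral.integral_const, smul_eq_mul]
  ring
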